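/- If X_n ~ Beta_p(a_n, a_n) with a_n → ∞, then √(8 a_n) (X_n − (1/2) I_p) converges in distribution to the Gaussian Unitary Ensemble GUE_p. -/

import Mathlib

open MeasureTheory Filter
open scoped ComplexOrder ENNReal Topology

attribute [local instance] Classical.propDecidable

noncomputable instance matrixMeasureSpace (p : ℕ) : MeasureSpace (Matrix (Fin p) (Fin p) ℂ) :=
  inferInstanceAs (MeasureSpace (Fin p → Fin p → ℂ))

/-- Parametrization of Hermitian matrices by their diagonal (real) entries and their
strictly upper triangular (complex) entries. -/
noncomputable def hermMk (p : ℕ)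
    (x : (Fin p → ℝ) × ({q : Fin p × Fin p // q.1 < q.2} → ℂ)) :
    Matrix (Fin p) (Fin p) ℂ :=
  Matrix.of fun i j =>
    if h : i < j then x.2 ⟨(i, j), h⟩
    else if h' : j < i then star (x.2 ⟨(j, i), h'⟩)
    else (x.1 i : ℂ)

/-- Lebesgue measure `∏_{i ≤ j} dx_{ij}^Re ∏_{i < j} dx_{ij}^Im` on the set of
Hermitian `p × p` complex matrices. -/
noncomputable def hermLebesgue (p : ℕ) : Measure (Matrix (Fin p) (Fin p) ℂ) :=
  Measure.map (hermMk p) volume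

/-- Normalization of a measure into a probability measure. -/
noncomputable def mnormalize {α : Type*} [MeasurableSpace α] (μ : Measure α) : Measure α :=
  (μ Set.univ)⁻¹ • μ

/-- The complex matrix Beta distribution `Beta_p(α, β)`, with density proportional to
`det(X)^(α-p) det(I-X)^(β-p)` on Hermitian matrices `0 < X < I`. -/
noncomputable def matrixBeta (p : ℕ) (α β : ℝ) : Measure (Matrix (Fin p) (Fin p) ℂ) :=
  mnormalize <| (hermLebesgue p).withDensity fun X =>
    if X.PosDef ∧ ((1 : Matrix (Fin p) (Fin p) ℂ) - X).PosDef then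
      ENNReal.ofReal (Real.rpow X.det.re (α - p) * Real.rpow (1 - X).det.re (β - p))
    else 0

/-- The complex Wishart distribution `W_p(a)`, with density proportional to
`det(X)^(a-p) e^(-tr X)` on positive definite Hermitian matrices. -/
noncomputable def wishart (p : ℕ) (a : ℝ) : Measure (Matrix (Fin p) (Fin p) ℂ) :=
  mnormalize <| (hermLebesgue p).withDensity fun X =>
    if X.PosDef then
      ENNReal.ofReal (Real.rpow X.det.re (a - p) * Real.exp (-X.trace.re))
    else 0

/-- The Gaussian Unitary Ensemble `GUE_p`, with density proportional to `exp(-tr(X²)/2)`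
on Hermitian matrices. -/
noncomputable def gue (p : ℕ) : Measure (Matrix (Fin p) (Fin p) ℂ) :=
  mnormalize <| (hermLebesgue p).withDensity fun X =>
    ENNReal.ofReal (Real.exp (-(X * X).trace.re / 2))

/-- Convergence in distribution of a sequence of laws to a limiting law. -/
def TendstoInDistribution {M : Type*} [MeasurableSpace M] [TopologicalSpace M]
    (μ : ℕ → Measure M) (ν : Measure M) : Prop :=
  ∀ f : BoundedContinuousFunction M ℝ,
    Tendsto (fun n => ∫ x, f x ∂(μ n)) atTop (𝓝 (∫ x, f x ∂ν))

/-- A sequence of measures satisfies a large deviation principle with speed `n` and good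
rate function `I`: `I` is lower semicontinuous with compact sublevel sets, and for every
Borel set `A`,
`-inf_{Int A} I ≤ liminf (1/n) log μ_n(A) ≤ limsup (1/n) log μ_n(A) ≤ -inf_{Clo A} I`. -/
def IsLDP {α : Type*} [TopologicalSpace α] [MeasurableSpace α]
    (μ : ℕ → Measure α) (I : α → EReal) : Prop :=
  LowerSemicontinuous I ∧ (∀ c : ℝ, IsCompact {x | I x ≤ (c : EReal)}) ∧
  ∀ A : Set α, MeasurableSet A →
    (-(⨅ x ∈ interior A, I x) ≤
        liminf (fun n : ℕ => (((n : ℝ)⁻¹ : ℝ) : EReal) * (μ n A).log) atTop ∧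
      limsup (fun n : ℕ => (((n : ℝ)⁻¹ : ℝ) : EReal) * (μ n A).log) atTop ≤
        -(⨅ x ∈ closure A, I x))

instance matrixBorelSpace (p : ℕ) : BorelSpace (Matrix (Fin p) (Fin p) ℂ) :=
  inferInstanceAs (BorelSpace (Fin p → Fin p → ℂ))

/-- A simultaneous diagonalization of the affine pencil `α + β Y` of a Hermitian matrix `Y`. -/
lemma Matrix.IsHermitian.exists_spectrum_pencil {p : ℕ} {Y : Matrix (Fin p) (Fin p) ℂ}
    (hY : Y.IsHermitian) : ∃ l : Fin p → ℝ,
      (∀ α β : ℝ, ((α • (1 : Matrix (Fin p) (Fin p) ℂ) + β • Y).PosDef ↔ ∀ i, 0 < α + β * l i) ∧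
        (α • (1 : Matrix (Fin p) (Fin p) ℂ) + β • Y).det.re = ∏ i, (α + β * l i)) ∧
      (Y * Y).trace.re = ∑ i, l i ^ 2 := by
  set U := (hY.eigenvectorUnitary : Matrix (Fin p) (Fin p) ℂ) with hU
  set l := hY.eigenvalues with hl
  have hUU : U * star U = 1 := Unitary.coe_mul_star_self hY.eigenvectorUnitary
  have hUU' : star U * U = 1 := Unitary.coe_star_mul_self hY.eigenvectorUnitary
  have hs : Y = U * Matrix.diagonal (fun i => (l i : ℂ)) * star U := by
    have := hY.spectral_theorem
    rw [Unitary.conjStarAlgAut_apply] at this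
    exact this
  have key : ∀ α β : ℝ, α • (1 : Matrix (Fin p) (Fin p) ℂ) + β • Y
      = U * Matrix.diagonal (fun i => ((α + β * l i : ℝ) : ℂ)) * star U := by
    intro α β
    have : Matrix.diagonal (fun i => ((α + β * l i : ℝ) : ℂ))
        = α • (1 : Matrix (Fin p) (Fin p) ℂ) + β • Matrix.diagonal (fun i => (l i : ℂ)) := by
      ext i j
      by_cases h : i = j
      · subst h; simp
      · simp [h]
    rw [this, Matrix.mul_add, Matrix.add_mul, Matrix.mul_smul, Matrix.mul_smul, Matrix.smul_mul,
      Matrix.smul_mul, Matrix.mul_one, hUU, ← hs]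
  refine ⟨l, fun α β => ⟨?_, ?_⟩, ?_⟩
  · rw [key, Matrix.IsUnit.posDef_star_right_conjugate_iff (IsUnit.of_mul_eq_one _ hUU),
      Matrix.posDef_diagonal_iff]
    exact forall_congr' fun i => Complex.zero_lt_real
  · rw [key, Matrix.det_mul_right_comm, hUU, Matrix.one_mul, Matrix.det_diagonal,
      ← Complex.ofReal_prod, Complex.ofReal_re]
  · have : Y * Y = U * Matrix.diagonal (fun i => ((l i ^ 2 : ℝ) : ℂ)) * star U := by
      have h2 : Matrix.diagonal (fun i => ((l i ^ 2 : ℝ) : ℂ))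
          = Matrix.diagonal (fun i => (l i : ℂ)) * Matrix.diagonal (fun i => (l i : ℂ)) := by
        rw [Matrix.diagonal_mul_diagonal]
        congr 1
        ext i
        push_cast
        ring
      rw [h2]
      conv_lhs => rw [hs]
      simp only [Matrix.mul_assoc]
      rw [← Matrix.mul_assoc (star U) U, hUU', Matrix.one_mul]
    rw [this, Matrix.trace_mul_comm, ← Matrix.mul_assoc, hUU', Matrix.one_mul,
      Matrix.trace_diagonal, ← Complex.ofReal_sum, Complex.ofReal_re]

lemma measurableSet_posDef (p : ℕ) :
    MeasurableSet {X : Matrix (Fin p) (Fin p) ℂ | X.PosDef} := by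
  have h : {X : Matrix (Fin p) (Fin p) ℂ | X.PosDef}
      = {X | X.PosSemidef} ∩ {X | X.det ≠ 0} := by
    ext X
    constructor
    · exact fun hX => ⟨hX.posSemidef, hX.det_pos.ne'⟩
    · exact fun hX => hX.1.posDef_iff_isUnit.mpr
        ((Matrix.isUnit_iff_isUnit_det X).mpr (isUnit_iff_ne_zero.mpr hX.2))
  rw [h]
  refine MeasurableSet.inter ?_ ?_
  · have : {X : Matrix (Fin p) (Fin p) ℂ | X.PosSemidef} = {X | X.conjTranspose = X} ∩
        ⋂ v : Fin p → ℂ, {X | 0 ≤ dotProduct (star v) (X.mulVec v)} := by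
      ext X
      simp [Matrix.posSemidef_iff_dotProduct_mulVec, Matrix.IsHermitian]
    rw [this]
    refine ((isClosed_eq (by fun_prop) (by fun_prop)).inter
      (isClosed_iInter fun v => ?_)).measurableSet
    exact isClosed_le continuous_const (by fun_prop)
  · exact (isOpen_ne_fun (by fun_prop) continuous_const).measurableSet

lemma continuous_hermMk (p : ℕ) : Continuous (hermMk p) := by
  unfold hermMk
  refine continuous_matrix fun i j => ?_
  by_cases h : i < j
  · simp only [Matrix.of_apply, h, dif_pos]; fun_prop
  · by_cases h' : j < i
    · simp only [Matrix.of_apply, h, h', dif_pos, dif_neg, not_false_eq_true]; fun_prop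
    · simp only [Matrix.of_apply, h, h', dif_neg, not_false_eq_true]; fun_prop

lemma isHermitian_hermMk (p : ℕ) (x : (Fin p → ℝ) × ({q : Fin p × Fin p // q.1 < q.2} → ℂ)) :
    (hermMk p x).IsHermitian := by
  ext i j
  rcases lt_trichotomy i j with h | h | h
  · simp [hermMk, h, h.not_gt]
  · subst h; simp [hermMk]
  · simp [hermMk, h, h.not_gt]

lemma hermMk_half_add_smul (p : ℕ) (c : ℝ)
    (y : (Fin p → ℝ) × ({q : Fin p × Fin p // q.1 < q.2} → ℂ)) :
    hermMk p ((fun _ => 1 / 2, 0) + c • y)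
      = (1 / 2 : ℝ) • (1 : Matrix (Fin p) (Fin p) ℂ) + c • hermMk p y := by
  ext i j
  rcases lt_trichotomy i j with h | h | h
  · simp [hermMk, h, h.ne]
  · subst h; simp [hermMk]
  · simp [hermMk, h, h.ne', h.not_gt]

lemma le_trace_hermMk_sq (p : ℕ) (x : (Fin p → ℝ) × ({q : Fin p × Fin p // q.1 < q.2} → ℂ)) :
    ∑ i, x.1 i ^ 2 + ∑ q, ‖x.2 q‖ ^ 2 ≤ (hermMk p x * hermMk p x).trace.re := by
  have h1 : (hermMk p x * hermMk p x).trace.re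
      = ∑ q : Fin p × Fin p, ‖hermMk p x q.1 q.2‖ ^ 2 := by
    rw [Fintype.sum_prod_type]
    simp only [Matrix.trace, Matrix.diag, Matrix.mul_apply, Complex.re_sum]
    refine Finset.sum_congr rfl fun i _ => Finset.sum_congr rfl fun j _ => ?_
    rw [← (isHermitian_hermMk p x).apply j i, Complex.star_def, Complex.mul_conj,
      Complex.ofReal_re, Complex.normSq_eq_norm_sq]
  have h2 : ∑ i, x.1 i ^ 2
      = ∑ q ∈ Finset.univ.filter (fun q : Fin p × Fin p => q.1 = q.2), ‖hermMk p x q.1 q.2‖ ^ 2 := by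
    refine Finset.sum_bij (fun i _ => (i, i)) (by simp) (by simp) ?_ (by simp [hermMk])
    rintro ⟨i, j⟩ h
    simp at h
    simp [h]
  have h3 : ∑ q, ‖x.2 q‖ ^ 2
      = ∑ q ∈ Finset.univ.filter (fun q : Fin p × Fin p => q.1 < q.2), ‖hermMk p x q.1 q.2‖ ^ 2 := by
    refine Finset.sum_bij (fun q _ => q.1) (fun q _ => by simp [q.2]) (by simp) ?_ ?_
    · intro b h
      exact ⟨⟨b, by simpa using h⟩, by simp⟩
    · rintro ⟨q, h⟩ _
      simp [hermMk, h]
  rw [h1, h2, h3, ← Finset.sum_union]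
  · exact Finset.sum_le_sum_of_subset_of_nonneg (Finset.subset_univ _) (fun _ _ _ => by positivity)
  · rw [Finset.disjoint_filter]
    exact fun q _ h => h.not_lt

lemma integrable_exp_neg_trace_hermMk_sq (p : ℕ) {b : ℝ} (hb : 0 < b) :
    Integrable (fun x => Real.exp (-b * (hermMk p x * hermMk p x).trace.re)) := by
  have hR : Integrable (fun x : Fin p → ℝ => ∏ i, Real.exp (-b * x i ^ 2)) :=
    Integrable.fintype_prod fun _ => integrable_exp_neg_mul_sq hb
  have hz : Integrable (fun z : ℂ => Real.exp (-b * ‖z‖ ^ 2)) := by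
    have := (GaussianFourier.integrable_cexp_neg_mul_sq_norm_add (V := ℂ) (b := (b : ℂ))
      (by simpa using hb) 0 0).norm
    simpa [Complex.norm_exp, ← Complex.ofReal_pow] using this
  have hC : Integrable (fun x : {q : Fin p × Fin p // q.1 < q.2} → ℂ =>
      ∏ q, Real.exp (-b * ‖x q‖ ^ 2)) :=
    Integrable.fintype_prod fun _ => hz
  refine (hR.mul_prod hC).mono' ?_ (ae_of_all _ fun x => ?_)
  · have := continuous_hermMk p
    exact Continuous.aestronglyMeasurable (by fun_prop)
  · rw [Real.norm_of_nonneg (Real.exp_pos _).le, ← Real.exp_sum, ← Real.exp_sum, ← Real.exp_add,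
      ← Finset.mul_sum, ← Finset.mul_sum, ← mul_add]
    exact Real.exp_le_exp.mpr
      (mul_le_mul_of_nonpos_left (le_trace_hermMk_sq p x) (by linarith))

/-- Integrals against the normalization of a density with respect to `hermLebesgue`. -/
lemma integral_mnormalize_hermLebesgue (p : ℕ) {r : Matrix (Fin p) (Fin p) ℂ → ℝ}
    (hr : Measurable r) (hr0 : ∀ X, 0 ≤ r X) {f : Matrix (Fin p) (Fin p) ℂ → ℝ}
    (hf : Measurable f) :
    ∫ X, f X ∂(mnormalize ((hermLebesgue p).withDensity fun X => ENNReal.ofReal (r X)))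
      = (∫ x, r (hermMk p x))⁻¹ * ∫ x, r (hermMk p x) * f (hermMk p x) := by
  have hm := (continuous_hermMk p).measurable
  rw [mnormalize, integral_smul_measure,
    integral_withDensity_eq_integral_toReal_smul hr.ennreal_ofReal (by simp), hermLebesgue,
    withDensity_apply _ MeasurableSet.univ, Measure.restrict_univ,
    lintegral_map hr.ennreal_ofReal hm, ENNReal.toReal_inv,
    integral_map hm.aemeasurable (by
      exact ((hr.ennreal_ofReal.ennreal_toReal).smul hf).aestronglyMeasurable),
    integral_eq_lintegral_of_nonneg_ae (ae_of_all _ fun x => hr0 _)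
      (hr.comp hm).aestronglyMeasurable]
  simp only [ENNReal.toReal_ofReal (hr0 _), smul_eq_mul]

/-- The unnormalized density of `matrixBeta p a a`. -/
noncomputable def betaDensity (p : ℕ) (a : ℝ) (X : Matrix (Fin p) (Fin p) ℂ) : ℝ :=
  if X.PosDef ∧ ((1 : Matrix (Fin p) (Fin p) ℂ) - X).PosDef then
    Real.rpow X.det.re (a - p) * Real.rpow (1 - X).det.re (a - p)
  else 0

lemma measurable_betaDensity (p : ℕ) (a : ℝ) : Measurable (betaDensity p a) := by
  have h0 : Measurable fun X : Matrix (Fin p) (Fin p) ℂ => 1 - X :=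
    (by fun_prop : Continuous fun X : Matrix (Fin p) (Fin p) ℂ => 1 - X).measurable
  refine Measurable.ite ((measurableSet_posDef p).inter
    (h0 (measurableSet_posDef p))) ?_ measurable_const
  have h1 : Measurable fun X : Matrix (Fin p) (Fin p) ℂ => X.det.re :=
    (by fun_prop : Continuous fun X : Matrix (Fin p) (Fin p) ℂ => X.det.re).measurable
  have h2 : Measurable fun X : Matrix (Fin p) (Fin p) ℂ => (1 - X).det.re :=
    (by fun_prop : Continuous fun X : Matrix (Fin p) (Fin p) ℂ => (1 - X).det.re).measurable
  exact (h1.pow_const (a - p)).mul (h2.pow_const (a - p))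

lemma betaDensity_nonneg (p : ℕ) (a : ℝ) (X : Matrix (Fin p) (Fin p) ℂ) :
    0 ≤ betaDensity p a X := by
  unfold betaDensity
  split_ifs with h
  · have h1 := (Complex.pos_iff.mp h.1.det_pos).1
    have h2 := (Complex.pos_iff.mp h.2.det_pos).1
    exact mul_nonneg (Real.rpow_nonneg h1.le _) (Real.rpow_nonneg h2.le _)
  · exact le_rfl

/-- The beta density around `1/2`, in terms of eigenvalues. -/
lemma betaDensity_half_add_smul {p : ℕ} {Y : Matrix (Fin p) (Fin p) ℂ} {l : Fin p → ℝ}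
    (hl : ∀ α β : ℝ, ((α • (1 : Matrix (Fin p) (Fin p) ℂ) + β • Y).PosDef ↔ ∀ i, 0 < α + β * l i) ∧
        (α • (1 : Matrix (Fin p) (Fin p) ℂ) + β • Y).det.re = ∏ i, (α + β * l i)) (a c : ℝ) :
    betaDensity p a ((1 / 2 : ℝ) • (1 : Matrix (Fin p) (Fin p) ℂ) + c • Y)
      = if ∀ i, 0 < 1 / 2 + c * l i ∧ 0 < 1 / 2 - c * l i then
          ∏ i, (1 / 4 * (1 - 4 * c ^ 2 * l i ^ 2)) ^ (a - p) else 0 := by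
  have h1 : (1 : Matrix (Fin p) (Fin p) ℂ) - ((1 / 2 : ℝ) • (1 : Matrix (Fin p) (Fin p) ℂ) + c • Y)
      = (1 / 2 : ℝ) • (1 : Matrix (Fin p) (Fin p) ℂ) + (-c) • Y := by
    rw [neg_smul, ← sub_sub, ← sub_eq_add_neg]
    congr 1
    nth_rewrite 1 [← one_smul ℝ (1 : Matrix (Fin p) (Fin p) ℂ)]
    rw [← sub_smul]
    norm_num
  have h2 : ((∀ i, 0 < 1 / 2 + c * l i) ∧ ∀ i, 0 < 1 / 2 + -c * l i) ↔
      ∀ i, 0 < 1 / 2 + c * l i ∧ 0 < 1 / 2 - c * l i := by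
    simp only [neg_mul, ← sub_eq_add_neg, forall_and]
  rw [← (hl _ _).1, ← (hl _ _).1, ← h1] at h2
  unfold betaDensity
  by_cases h : ∀ i, 0 < 1 / 2 + c * l i ∧ 0 < 1 / 2 - c * l i
  swap
  · rw [if_neg (h2.not.mpr h), if_neg h]
  rw [if_pos (h2.mpr h), if_pos h, h1, (hl _ _).2, (hl _ _).2]
  simp only [neg_mul, ← sub_eq_add_neg]
  change (∏ i, (1 / 2 + c * l i)) ^ (a - p) * (∏ i, (1 / 2 - c * l i)) ^ (a - p) = _
  rw [← Real.mul_rpow (Finset.prod_nonneg fun i _ => (h i).1.le)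
    (Finset.prod_nonneg fun i _ => (h i).2.le), ← Finset.prod_mul_distrib,
    ← Real.finsetProd_rpow _ _ fun i _ => (mul_pos (h i).1 (h i).2).le]
  refine Finset.prod_congr rfl fun i _ => ?_
  congr 1
  ring

/-- The density of `√(8 a) (X - 1/2)` at `Y`, for `X` distributed as `matrixBeta p a a`, normalized
to have value `1` at `0`. -/
noncomputable def scaledBetaDensity (p : ℕ) (a : ℝ) (Y : Matrix (Fin p) (Fin p) ℂ) : ℝ :=
  ((4 : ℝ) ^ (a - p)) ^ p *
    betaDensity p a ((1 / 2 : ℝ) • (1 : Matrix (Fin p) (Fin p) ℂ) + (Real.sqrt (8 * a))⁻¹ • Y)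

lemma scaledBetaDensity_eq {p : ℕ} {Y : Matrix (Fin p) (Fin p) ℂ} {l : Fin p → ℝ}
    (hl : ∀ α β : ℝ, ((α • (1 : Matrix (Fin p) (Fin p) ℂ) + β • Y).PosDef ↔ ∀ i, 0 < α + β * l i) ∧
        (α • (1 : Matrix (Fin p) (Fin p) ℂ) + β • Y).det.re = ∏ i, (α + β * l i))
    {a : ℝ} (ha : 0 < a) :
    scaledBetaDensity p a Y = if ∀ i, l i ^ 2 / (2 * a) < 1 then
          ∏ i, (1 - l i ^ 2 / (2 * a)) ^ (a - p) else 0 := by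
  have hc : 4 * (Real.sqrt (8 * a))⁻¹ ^ 2 = 1 / (2 * a) := by
    rw [inv_pow, Real.sq_sqrt (by positivity)]
    field_simp
    norm_num
  set c := (Real.sqrt (8 * a))⁻¹
  have hcl : ∀ x : ℝ, x ^ 2 / (2 * a) = 4 * c ^ 2 * x ^ 2 := fun x => by
    rw [hc]; ring
  have hiff : (∀ i, 0 < 1 / 2 + c * l i ∧ 0 < 1 / 2 - c * l i) ↔ ∀ i, l i ^ 2 / (2 * a) < 1 := by
    refine forall_congr' fun i => ?_
    rw [hcl]
    constructor
    · rintro ⟨h1, h2⟩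
      nlinarith [mul_pos h1 h2]
    · intro h
      have := abs_lt_of_sq_lt_sq (a := 2 * (c * l i)) (b := 1) (by linarith) zero_le_one
      constructor <;> linarith [abs_lt.mp this]
  rw [scaledBetaDensity, betaDensity_half_add_smul hl, mul_ite, mul_zero]
  refine if_ctx_congr hiff (fun h => ?_) fun _ => rfl
  have hp : ((4 : ℝ) ^ (a - p)) ^ p = ∏ _i : Fin p, (4 : ℝ) ^ (a - p) := by simp
  rw [hp, ← Finset.prod_mul_distrib]
  refine Finset.prod_congr rfl fun i _ => ?_
  have := h i
  rw [← hcl, ← Real.mul_rpow (by norm_num) (by linarith)]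
  congr 1
  ring

lemma scaledBetaDensity_le {p : ℕ} {Y : Matrix (Fin p) (Fin p) ℂ} (hY : Y.IsHermitian)
    {a : ℝ} (ha : 0 < a) (hap : 2 * p ≤ a) :
    scaledBetaDensity p a Y ≤ Real.exp (-(1 / 4) * (Y * Y).trace.re) := by
  obtain ⟨l, hl, hl2⟩ := hY.exists_spectrum_pencil
  rw [scaledBetaDensity_eq hl ha, hl2, Finset.mul_sum, Real.exp_sum]
  split_ifs with h
  · refine Finset.prod_le_prod (fun i _ => Real.rpow_nonneg (by linarith [h i]) _) fun i _ => ?_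
    calc (1 - l i ^ 2 / (2 * a)) ^ (a - p)
        ≤ Real.exp (-(l i ^ 2 / (2 * a))) ^ (a - p) :=
          Real.rpow_le_rpow (by linarith [h i]) (Real.one_sub_le_exp_neg _) (by linarith)
      _ = Real.exp (-(l i ^ 2 / (2 * a)) * (a - p)) := (Real.exp_mul _ _).symm
      _ ≤ _ := by
          refine Real.exp_le_exp.mpr ?_
          have : l i ^ 2 / (2 * a) * (a - p) ≥ l i ^ 2 / (2 * a) * (a / 2) :=
            mul_le_mul_of_nonneg_left (by linarith) (by positivity)
          have h3 : l i ^ 2 / (2 * a) * (a / 2) = 1 / 4 * l i ^ 2 := by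
            field_simp
            norm_num
          linarith
  · exact Finset.prod_nonneg fun i _ => (Real.exp_pos _).le

lemma scaledBetaDensity_nonneg (p : ℕ) (a : ℝ) (Y : Matrix (Fin p) (Fin p) ℂ) :
    0 ≤ scaledBetaDensity p a Y :=
  mul_nonneg (by positivity) (betaDensity_nonneg _ _ _)

lemma measurable_scaledBetaDensity (p : ℕ) (a : ℝ) : Measurable (scaledBetaDensity p a) := by
  refine ((measurable_betaDensity p a).comp ?_).const_mul _
  exact Continuous.measurable (by fun_prop)

lemma tendsto_one_sub_div_rpow_sub (t q : ℝ) :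
    Tendsto (fun a : ℝ => (1 - t / a) ^ (a - q)) atTop (𝓝 (Real.exp (-t))) := by
  have h0 : Tendsto (fun a : ℝ => 1 - t / a) atTop (𝓝 1) := by
    simpa using (tendsto_const_nhds (x := (1 : ℝ))).sub
      (tendsto_const_nhds (x := t).div_atTop tendsto_id)
  have h1 := Real.tendsto_one_add_div_rpow_exp (-t)
  have h2 : Tendsto (fun a : ℝ => (1 - t / a) ^ q) atTop (𝓝 1) := by
    simpa using h0.rpow_const (p := q) (Or.inl one_ne_zero)
  have h3 := h1.div h2 one_ne_zero
  rw [div_one] at h3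
  refine h3.congr' ?_
  filter_upwards [h0.eventually_const_lt zero_lt_one] with a ha
  simp only [Pi.div_apply, neg_div, ← sub_eq_add_neg]
  rw [Real.rpow_sub ha]

lemma tendsto_scaledBetaDensity {p : ℕ} {Y : Matrix (Fin p) (Fin p) ℂ} (hY : Y.IsHermitian) :
    Tendsto (fun a => scaledBetaDensity p a Y) atTop
      (𝓝 (Real.exp (-(Y * Y).trace.re / 2))) := by
  obtain ⟨l, hl, hl2⟩ := hY.exists_spectrum_pencil
  have h : Tendsto (fun a : ℝ => ∏ i, (1 - (l i ^ 2 / 2) / a) ^ (a - p)) atTop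
      (𝓝 (∏ i, Real.exp (-(l i ^ 2 / 2)))) :=
    tendsto_finsetProd _ fun i _ => tendsto_one_sub_div_rpow_sub _ _
  have he : -(Y * Y).trace.re / 2 = ∑ i, -(l i ^ 2 / 2) := by
    rw [hl2, Finset.sum_neg_distrib, neg_div, Finset.sum_div]
  rw [he, Real.exp_sum]
  refine h.congr' ?_
  have hlt : ∀ᶠ a : ℝ in atTop, ∀ i, (l i ^ 2 / 2) / a < 1 :=
    eventually_all.mpr fun i =>
      (tendsto_const_nhds.div_atTop tendsto_id).eventually_lt_const zero_lt_one
  filter_upwards [hlt, eventually_gt_atTop 0] with a h1 h2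
  simp only [div_div] at h1 ⊢
  rw [scaledBetaDensity_eq hl h2, if_pos h1]

instance isAddHaarMeasure_volume_hermCoordinates (p : ℕ) :
    (volume : Measure ((Fin p → ℝ) × ({q : Fin p × Fin p // q.1 < q.2} → ℂ))).IsAddHaarMeasure :=
  Measure.prod.instIsAddHaarMeasure _ _

/-- Change of variables `X = 1/2 + Y / √(8 a)`, up to a constant. -/
lemma exists_integral_betaDensity_eq (p : ℕ) {a : ℝ} (ha : 0 < a) : ∃ K : ℝ, K ≠ 0 ∧
    ∀ f : Matrix (Fin p) (Fin p) ℂ → ℝ,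
      ∫ x, scaledBetaDensity p a (hermMk p x) * f (hermMk p x) =
        K * ∫ x, betaDensity p a (hermMk p x) *
          f (Real.sqrt (8 * a) • (hermMk p x - (1 / 2 : ℝ) • (1 : Matrix (Fin p) (Fin p) ℂ))) := by
  have hc : 0 < Real.sqrt (8 * a) := Real.sqrt_pos.mpr (by positivity)
  set c := Real.sqrt (8 * a) with hcdef
  let E := (Fin p → ℝ) × ({q : Fin p × Fin p // q.1 < q.2} → ℂ)
  refine ⟨((4 : ℝ) ^ (a - p)) ^ p * |(c⁻¹ ^ Module.finrank ℝ E)⁻¹|, by positivity, fun f => ?_⟩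
  set g : E → ℝ := fun x => betaDensity p a (hermMk p x) *
        f (c • (hermMk p x - (1 / 2 : ℝ) • (1 : Matrix (Fin p) (Fin p) ℂ))) with hg
  have h1 := Measure.integral_comp_smul (volume : Measure E)
    (fun y => g ((fun _ => 1 / 2, 0) + y)) c⁻¹
  rw [integral_add_left_eq_self, smul_eq_mul] at h1
  rw [mul_assoc, ← h1, ← integral_const_mul]
  refine integral_congr_ae (ae_of_all _ fun y => ?_)
  have hy := hermMk_half_add_smul p c⁻¹ y
  simp only [hg, scaledBetaDensity, ← hcdef]
  rw [hy, add_sub_cancel_left, smul_inv_smul₀ hc.ne', mul_assoc]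

lemma integral_map_matrixBeta (p : ℕ) {a : ℝ} (ha : 0 < a)
    (f : BoundedContinuousFunction (Matrix (Fin p) (Fin p) ℂ) ℝ) :
    ∫ Y, f Y ∂(Measure.map
        (fun X : Matrix (Fin p) (Fin p) ℂ =>
          Real.sqrt (8 * a) • (X - (1 / 2 : ℝ) • (1 : Matrix (Fin p) (Fin p) ℂ)))
        (matrixBeta p a a))
      = (∫ x, scaledBetaDensity p a (hermMk p x))⁻¹ *
        ∫ x, scaledBetaDensity p a (hermMk p x) * f (hermMk p x) := by
  have hφ : Continuous (fun X : Matrix (Fin p) (Fin p) ℂ =>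
      Real.sqrt (8 * a) • (X - (1 / 2 : ℝ) • (1 : Matrix (Fin p) (Fin p) ℂ))) := by fun_prop
  have hb : matrixBeta p a a = mnormalize ((hermLebesgue p).withDensity fun X =>
      ENNReal.ofReal (betaDensity p a X)) := by
    unfold matrixBeta betaDensity
    congr 2
    ext X
    split_ifs <;> simp
  have hfφ : Measurable fun X : Matrix (Fin p) (Fin p) ℂ =>
      f (Real.sqrt (8 * a) • (X - (1 / 2 : ℝ) • (1 : Matrix (Fin p) (Fin p) ℂ))) :=
    f.continuous.measurable.comp hφ.measurable
  obtain ⟨K, hK, h⟩ := exists_integral_betaDensity_eq p ha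
  have h1 := h fun _ => 1
  simp only [mul_one] at h1
  rw [integral_map hφ.measurable.aemeasurable f.continuous.measurable.aestronglyMeasurable, hb,
    integral_mnormalize_hermLebesgue p (measurable_betaDensity p a) (betaDensity_nonneg p a) hfφ,
    h, h1]
  field_simp

lemma integral_gue (p : ℕ) (f : BoundedContinuousFunction (Matrix (Fin p) (Fin p) ℂ) ℝ) :
    ∫ Y, f Y ∂(gue p) = (∫ x, Real.exp (-(hermMk p x * hermMk p x).trace.re / 2))⁻¹ *
        ∫ x, Real.exp (-(hermMk p x * hermMk p x).trace.re / 2) * f (hermMk p x) :=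
  integral_mnormalize_hermLebesgue p (Continuous.measurable (by fun_prop))
    (fun _ => (Real.exp_pos _).le) f.continuous.measurable

lemma tendsto_integral_scaledBetaDensity (p : ℕ)
    (f : BoundedContinuousFunction (Matrix (Fin p) (Fin p) ℂ) ℝ) :
    Tendsto (fun a => ∫ x, scaledBetaDensity p a (hermMk p x) * f (hermMk p x)) atTop
      (𝓝 (∫ x, Real.exp (-(hermMk p x * hermMk p x).trace.re / 2) * f (hermMk p x))) := by
  have hm := (continuous_hermMk p).measurable
  refine tendsto_integral_filter_of_dominated_convergence
    (fun x => Real.exp (-(1 / 4) * (hermMk p x * hermMk p x).trace.re) * ‖f‖)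
    (Eventually.of_forall fun a => ?_) ?_
    ((integrable_exp_neg_trace_hermMk_sq p (by norm_num)).mul_const _) (ae_of_all _ fun x => ?_)
  · exact (((measurable_scaledBetaDensity p a).comp hm).mul
      (f.continuous.measurable.comp hm)).aestronglyMeasurable
  · filter_upwards [eventually_gt_atTop 0, eventually_ge_atTop (2 * p : ℝ)] with a h1 h2
    refine ae_of_all _ fun x => ?_
    rw [norm_mul, Real.norm_of_nonneg (scaledBetaDensity_nonneg _ _ _)]
    exact mul_le_mul (scaledBetaDensity_le (isHermitian_hermMk p x) h1 h2) (f.norm_coe_le_norm _)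
      (norm_nonneg _) (Real.exp_pos _).le
  · exact (tendsto_scaledBetaDensity (isHermitian_hermMk p x)).mul_const _

/-- If `X_n ~ Beta_p(a_n, a_n)` with `a_n → ∞`, then `√(8 a_n) (X_n - ½ I)` converges in
distribution to the Gaussian Unitary Ensemble `GUE_p`. -/
theorem matrixBeta_tendsto_gue (p : ℕ) (a : ℕ → ℝ) (hpos : ∀ n, 0 < a n)
    (ha : Tendsto a atTop atTop) :
    TendstoInDistribution
      (fun n => Measure.map
        (fun X : Matrix (Fin p) (Fin p) ℂ =>
          Real.sqrt (8 * a n) • (X - (1 / 2 : ℝ) • (1 : Matrix (Fin p) (Fin p) ℂ)))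
        (matrixBeta p (a n) (a n)))
      (gue p) := by
  intro f
  have hne : NeZero
      (volume : Measure ((Fin p → ℝ) × ({q : Fin p × Fin p // q.1 < q.2} → ℂ))) :=
    have := (isAddHaarMeasure_volume_hermCoordinates p).toIsOpenPosMeasure
    ⟨isOpen_univ.measure_ne_zero volume Set.univ_nonempty ∘ Measure.measure_univ_eq_zero.mpr⟩
  have hpos_int : 0 < ∫ x, Real.exp (-(hermMk p x * hermMk p x).trace.re / 2) := by
    refine integral_exp_pos ?_
    convert integrable_exp_neg_trace_hermMk_sq p (b := 1 / 2) (by norm_num) using 3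
    ring
  have h1 := tendsto_integral_scaledBetaDensity p (BoundedContinuousFunction.const _ 1)
  simp only [BoundedContinuousFunction.const_apply, mul_one] at h1
  have h := ((h1.inv₀ hpos_int.ne').mul (tendsto_integral_scaledBetaDensity p f)).comp ha
  rw [integral_gue]
  refine h.congr fun n => ?_
  rw [integral_map_matrixBeta p (hpos n) f, Function.comp_apply]
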